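/- The image S(B) is relatively compact in the space of bounded continuous functions on ℝ with the supremum norm: every sequence (Fₙ) with Fₙ = S(Gₙ) for some Gₙ ∈ B possesses a subsequence that converges uniformly on all of ℝ to a bounded continuous function. -/

import Mathlib

open MeasureTheory Real Filter

noncomputable section

/-- The fixed-point map S(F)(ξ) = ∫∫ e^{-|ξ-ξ̃|} F(2ξ̃-ξ*) F(ξ*) dξ* dξ̃. -/
def S (F : ℝ → ℝ) : ℝ → ℝ := fun ξ =>
  ∫ η : ℝ, ∫ ζ : ℝ, Real.exp (-|ξ - η|) * F (2*η - ζ) * F ζ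

/-- The set B of nonnegative, even, bounded continuous integrable functions with
total integral 1 and second moment 4. -/
def memB (F : ℝ → ℝ) : Prop :=
  Continuous F ∧ (∀ ξ, 0 ≤ F ξ) ∧ (∀ ξ, F (-ξ) = F ξ) ∧
  MeasureTheory.Integrable F ∧ (∃ K : ℝ, ∀ ξ, |F ξ| ≤ K) ∧
  (∫ ξ : ℝ, F ξ) = 1 ∧
  MeasureTheory.Integrable (fun ξ : ℝ => ξ^2 * F ξ) ∧
  (∫ ξ : ℝ, ξ^2 * F ξ) = 4

lemma shift_integral (A : ℝ → ℝ) (z : ℝ) :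
    ∫ x : ℝ, A (2 * x - z) = (1/2) * ∫ x, A x := by
  have h := Measure.integral_comp_mul_left (fun y => A (y - z)) (2:ℝ)
  rw [integral_sub_right_eq_self (fun y => A y) z] at h
  rw [h, abs_of_pos (by norm_num)]
  simp

lemma shift_integrable (A : ℝ → ℝ) (hA : Integrable A) (z : ℝ) :
    Integrable (fun x : ℝ => A (2 * x - z)) :=
  (hA.comp_sub_right z).comp_mul_left' (R := 2) (by norm_num)

lemma prod_integrable (A B : ℝ → ℝ) (hA : Integrable A) (hB : Integrable B)
    (cA : Continuous A) (cB : Continuous B) :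
    Integrable (fun p : ℝ × ℝ => A (2 * p.1 - p.2) * B p.2)
      ((volume : Measure ℝ).prod volume) := by
  have hc : Continuous (fun p : ℝ × ℝ => A (2 * p.1 - p.2) * B p.2) := by fun_prop
  rw [integrable_prod_iff' hc.aestronglyMeasurable]
  refine ⟨Eventually.of_forall fun z => (shift_integrable A hA z).mul_const (B z), ?_⟩
  have : (fun y => ∫ x, ‖A (2 * x - y) * B y‖) = fun y => ((1/2) * ∫ x, ‖A x‖) * ‖B y‖ := by
    funext y
    simp_rw [norm_mul]
    rw [integral_mul_const, shift_integral (fun x => ‖A x‖) y]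
  simp only [this]
  exact hB.norm.const_mul _

lemma prod_integral (A B : ℝ → ℝ) (hA : Integrable A) (hB : Integrable B)
    (cA : Continuous A) (cB : Continuous B) :
    ∫ p : ℝ × ℝ, A (2 * p.1 - p.2) * B p.2 ∂((volume : Measure ℝ).prod volume)
      = (1/2) * (∫ x, A x) * ∫ x, B x := by
  rw [integral_prod_symm _ (prod_integrable A B hA hB cA cB)]
  simp_rw [integral_mul_const, shift_integral A]
  rw [integral_const_mul]

lemma exp_abs_lip (a b : ℝ) : |Real.exp (-|a|) - Real.exp (-|b|)| ≤ |a - b| := by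
  have key : ∀ a b : ℝ, Real.exp (-|a|) - Real.exp (-|b|) ≤ |a - b| := by
    intro a b
    have h1 : 1 - (|b| - |a|) ≤ Real.exp (-(|b| - |a|)) := by
      have := Real.add_one_le_exp (-(|b| - |a|)); linarith
    have h2 : Real.exp (-|b|) = Real.exp (-|a|) * Real.exp (-(|b| - |a|)) := by
      rw [← Real.exp_add]; congr 1; ring
    have h3 : Real.exp (-|a|) ≤ 1 := Real.exp_le_one_iff.2 (by simp)
    have h4 := Real.exp_pos (-|a|)
    have h5 : |b| - |a| ≤ |a - b| := by rw [abs_sub_comm]; exact abs_sub_abs_le_abs_sub b a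
    have h6 := abs_nonneg (a - b)
    rw [h2]
    have h7 := mul_le_mul_of_nonneg_left h1 h4.le
    have h8 := mul_le_mul_of_nonneg_left h5 h4.le
    nlinarith
  rw [abs_le]
  have := key b a
  rw [abs_sub_comm] at this
  exact ⟨by linarith, key a b⟩

lemma sq_exp_le (t : ℝ) : t ^ 2 * Real.exp (-|t|) ≤ 2 := by
  have h := Real.quadratic_le_exp_of_nonneg (abs_nonneg t)
  have h2 : t ^ 2 ≤ 2 * Real.exp |t| := by
    have := abs_nonneg t
    rw [← sq_abs]; nlinarith
  calc t ^ 2 * Real.exp (-|t|) ≤ 2 * Real.exp |t| * Real.exp (-|t|) :=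
        mul_le_mul_of_nonneg_right h2 (Real.exp_pos _).le
    _ = 2 := by rw [mul_assoc, ← Real.exp_add]; simp

lemma kern_integrable (F : ℝ → ℝ) (hF : memB F) (ξ : ℝ) :
    Integrable (fun p : ℝ × ℝ => Real.exp (-|ξ - p.1|) * (F (2 * p.1 - p.2) * F p.2))
      ((volume : Measure ℝ).prod volume) := by
  obtain ⟨c, -, -, hi, -⟩ := hF
  refine (prod_integrable F F hi hi c c).bdd_mul (c := 1)
    (by apply Continuous.aestronglyMeasurable; fun_prop) (Eventually.of_forall fun p => ?_)
  rw [Real.norm_eq_abs, abs_of_pos (Real.exp_pos _)]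
  exact Real.exp_le_one_iff.2 (by simp)

lemma S_eq (F : ℝ → ℝ) (hF : memB F) (ξ : ℝ) :
    S F ξ = ∫ p : ℝ × ℝ, Real.exp (-|ξ - p.1|) * (F (2 * p.1 - p.2) * F p.2)
      ∂((volume : Measure ℝ).prod volume) := by
  rw [integral_prod _ (kern_integrable F hF ξ)]
  simp only [S, mul_assoc]

lemma S_nonneg (F : ℝ → ℝ) (hF : memB F) (ξ : ℝ) : 0 ≤ S F ξ := by
  rw [S_eq F hF]
  exact integral_nonneg fun p =>
    mul_nonneg (Real.exp_pos _).le (mul_nonneg (hF.2.1 _) (hF.2.1 _))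

lemma S_le (F : ℝ → ℝ) (hF : memB F) (ξ : ℝ) : S F ξ ≤ 1 := by
  rw [S_eq F hF]
  have hk := kern_integrable F hF ξ
  obtain ⟨c, h0, -, hi, -, h1, -⟩ := hF
  calc _ ≤ ∫ p : ℝ × ℝ, F (2 * p.1 - p.2) * F p.2 ∂((volume : Measure ℝ).prod volume) := by
        refine integral_mono hk (prod_integrable F F hi hi c c) fun p => ?_
        exact mul_le_of_le_one_left (mul_nonneg (h0 _) (h0 _))
          (Real.exp_le_one_iff.2 (by simp))
    _ ≤ 1 := by rw [prod_integral F F hi hi c c, h1]; norm_num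

lemma S_lip (F : ℝ → ℝ) (hF : memB F) (x y : ℝ) : |S F x - S F y| ≤ |x - y| := by
  rw [S_eq F hF, S_eq F hF, ← integral_sub (kern_integrable F hF x) (kern_integrable F hF y)]
  obtain ⟨c, h0, -, hi, -, h1, -⟩ := hF
  rw [← Real.norm_eq_abs (integral _ _)]
  calc _ ≤ ∫ p : ℝ × ℝ, |x - y| * (F (2 * p.1 - p.2) * F p.2)
            ∂((volume : Measure ℝ).prod volume) := by
        refine norm_integral_le_of_norm_le
          ((prod_integrable F F hi hi c c).const_mul _) (Eventually.of_forall fun p => ?_)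
        rw [← sub_mul, norm_mul, Real.norm_eq_abs, Real.norm_eq_abs,
          abs_of_nonneg (mul_nonneg (h0 _) (h0 _))]
        refine mul_le_mul_of_nonneg_right ?_ (mul_nonneg (h0 _) (h0 _))
        have := exp_abs_lip (x - p.1) (y - p.1)
        rwa [sub_sub_sub_cancel_right] at this
    _ ≤ |x - y| := by
        rw [integral_const_mul, prod_integral F F hi hi c c, h1]
        have := abs_nonneg (x - y)
        linarith

lemma S_decay (F : ℝ → ℝ) (hF : memB F) (x : ℝ) : x ^ 2 * S F x ≤ 6 := by
  rw [S_eq F hF, ← integral_const_mul]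
  have hk := kern_integrable F hF x
  obtain ⟨c, h0, -, hi, -, h1, hi2, h2⟩ := hF
  have c2 : Continuous (fun x : ℝ => x ^ 2 * F x) := by fun_prop
  have I0 := (prod_integrable F F hi hi c c).const_mul 4
  have I1 := prod_integrable _ F hi2 hi c2 c
  have I2 := prod_integrable F _ hi hi2 c c2
  calc _ ≤ ∫ p : ℝ × ℝ, (4 * (F (2 * p.1 - p.2) * F p.2)
            + ((2 * p.1 - p.2) ^ 2 * F (2 * p.1 - p.2)) * F p.2
            + F (2 * p.1 - p.2) * (p.2 ^ 2 * F p.2))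
            ∂((volume : Measure ℝ).prod volume) := by
        refine integral_mono (hk.const_mul _) ((I0.add I1).add I2) fun p => ?_
        have hw := mul_nonneg (h0 (2 * p.1 - p.2)) (h0 p.2)
        have e1 : Real.exp (-|x - p.1|) ≤ 1 := Real.exp_le_one_iff.2 (by simp)
        have e0 := Real.exp_pos (-|x - p.1|)
        have e2 := sq_exp_le (x - p.1)
        have e3 : x ^ 2 * Real.exp (-|x - p.1|) ≤ 4 + (2 * p.1 - p.2) ^ 2 + p.2 ^ 2 := by
          have a1 : x ^ 2 ≤ 2 * (x - p.1) ^ 2 + 2 * p.1 ^ 2 := by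
            nlinarith [sq_nonneg (x - 2 * p.1)]
          have a2 := mul_le_mul_of_nonneg_right a1 e0.le
          have a3 : p.1 ^ 2 * Real.exp (-|x - p.1|) ≤ p.1 ^ 2 :=
            mul_le_of_le_one_right (sq_nonneg _) e1
          nlinarith [sq_nonneg (2 * p.1 - 2 * p.2)]
        have := mul_le_mul_of_nonneg_right e3 hw
        simp only
        linarith
    _ ≤ 6 := by
        have J1 := prod_integral _ F hi2 hi c2 c
        have J2 := prod_integral F _ hi hi2 c c2
        have I01 : Integrable (fun p : ℝ × ℝ => 4 * (F (2 * p.1 - p.2) * F p.2)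
            + ((2 * p.1 - p.2) ^ 2 * F (2 * p.1 - p.2)) * F p.2)
            ((volume : Measure ℝ).prod volume) := I0.add I1
        rw [integral_add I01 I2, integral_add I0 I1, integral_const_mul,
          prod_integral F F hi hi c c, J1, J2, h1, h2]
        norm_num

lemma exists_subseq (u : ℕ → ℝ → ℝ) (h0 : ∀ n x, 0 ≤ u n x) (h1 : ∀ n x, u n x ≤ 1) :
    ∃ σ : ℕ → ℕ, StrictMono σ ∧ ∀ q : ℚ, CauchySeq (fun n => u (σ n) q) := by
  have hc : IsCompact (Set.univ.pi fun _ : ℚ => Set.Icc (0:ℝ) 1) :=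
    isCompact_univ_pi fun _ => isCompact_Icc
  obtain ⟨a, -, σ, hσ, ht⟩ := hc.isSeqCompact (x := fun n (q : ℚ) => u n q)
    (fun n q _ => ⟨h0 n q, h1 n q⟩)
  exact ⟨σ, hσ, fun q => ((tendsto_pi_nhds.1 ht) q).cauchySeq⟩

theorem S_image_relatively_compact
    (G : ℕ → ℝ → ℝ) (hG : ∀ n, memB (G n)) :
    ∃ (f : ℝ → ℝ) (σ : ℕ → ℕ), StrictMono σ ∧
      Continuous f ∧ (∃ K : ℝ, ∀ ξ, |f ξ| ≤ K) ∧
      TendstoUniformly (fun n => S (G (σ n))) f Filter.atTop := by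
  obtain ⟨σ, hσ, hq⟩ := exists_subseq (fun n => S (G n)) (fun n => S_nonneg _ (hG n))
    (fun n => S_le _ (hG n))
  have hU : UniformCauchySeqOn (fun n => S (G (σ n))) atTop Set.univ := by
    rw [Metric.uniformCauchySeqOn_iff]
    intro ε hε
    obtain ⟨R, hR1, hR⟩ : ∃ R : ℝ, 1 ≤ R ∧ 6 < ε * R := by
      refine ⟨6 / ε + 1, by have : 0 < 6 / ε := by positivity
                            linarith, ?_⟩
      rw [mul_add, mul_div_cancel₀ _ hε.ne']; linarith
    obtain ⟨t, ht⟩ := (isCompact_Icc (a := -R) (b := R)).elim_finite_subcover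
      (fun q : ℚ => Metric.ball (q:ℝ) (ε / 3)) (fun _ => Metric.isOpen_ball) (by
        intro x _
        obtain ⟨q, hq⟩ := Rat.denseRange_cast.exists_dist_lt x (by positivity : 0 < ε / 3)
        exact Set.mem_iUnion.2 ⟨q, hq⟩)
    choose N hN using fun q => Metric.cauchySeq_iff.1 (hq q) (ε / 3) (by positivity)
    refine ⟨t.sup N, fun m hm n hn x _ => ?_⟩
    by_cases hx : x ∈ Set.Icc (-R) R
    · obtain ⟨q, hqt, hxq⟩ := Set.mem_iUnion₂.1 (ht hx)
      have a := hN q m (le_trans (Finset.le_sup hqt) hm) n (le_trans (Finset.le_sup hqt) hn)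
      have b := S_lip _ (hG (σ m)) x q
      have c := S_lip _ (hG (σ n)) x q
      rw [Metric.mem_ball, Real.dist_eq] at hxq
      rw [Real.dist_eq, abs_lt] at *
      rw [abs_le] at b c
      have := abs_lt.2 hxq
      constructor <;> linarith
    · have hx2 : R ≤ x ^ 2 := by
        rw [Set.mem_Icc, ← abs_le, not_le] at hx
        rw [← sq_abs]; nlinarith
      have tail : ∀ k, S (G k) x < ε := by
        intro k
        have d := S_decay _ (hG k) x
        by_contra! hcon
        have : ε * R ≤ x ^ 2 * S (G k) x := by
          rw [mul_comm]; exact mul_le_mul hx2 hcon hε.le (sq_nonneg _)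
        linarith
      rw [Real.dist_eq, abs_lt]
      have := tail (σ m)
      have := tail (σ n)
      have := S_nonneg _ (hG (σ m)) x
      have := S_nonneg _ (hG (σ n)) x
      constructor <;> linarith
  choose f hf using fun x => cauchySeq_tendsto_of_complete (hU.cauchySeq (Set.mem_univ x))
  have hT : TendstoUniformly (fun n => S (G (σ n))) f atTop := by
    rw [← tendstoUniformlyOn_univ]
    exact hU.tendstoUniformlyOn_of_tendsto fun x _ => hf x
  refine ⟨f, σ, hσ, hT.continuous (Frequently.of_forall fun n => ?_), ⟨1, fun x => ?_⟩, hT⟩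
  · refine (LipschitzWith.of_dist_le_mul (K := 1) fun x y => ?_).continuous
    simpa [Real.dist_eq] using S_lip _ (hG (σ n)) x y
  · have a := ge_of_tendsto' (hf x) fun n => S_nonneg _ (hG (σ n)) x
    have b := le_of_tendsto' (hf x) fun n => S_le _ (hG (σ n)) x
    rw [abs_le]; constructor <;> linarith
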